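/- Let $A$ be a Gorenstein local ring and $\mathfrak{q}$ a prime ideal of grade $g$. Then the set of associated primes of the local cohomology module $\operatorname{H}^g_{\mathfrak{q}}(A)$ is exactly $\{\mathfrak{q}\}$. -/

import Mathlib

open CategoryTheory Opposite

universe u

variable (R : Type u) [CommRing R]

/-- The Ext module `Ext^i_R(M, N)`. -/
noncomputable abbrev ExtMod (i : ℕ) (M N : ModuleCat.{u} R) : ModuleCat.{u} R :=
  ((Ext R (ModuleCat.{u} R) i).obj (op M)).obj N

/-- A Noetherian local ring is Gorenstein if it has finite injective dimension
as a module over itself, i.e. `Ext^i(N, R)` vanishes for all `i` large and all `N`. -/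
def IsGorensteinLocalRing : Prop :=
  IsNoetherianRing R ∧ IsLocalRing R ∧
    ∃ n : ℕ, ∀ i : ℕ, n < i → ∀ N : ModuleCat.{u} R,
      Subsingleton (ExtMod R i N (ModuleCat.of R R))

section Support

variable {R}

lemma Module.notMem_support_of_exact {A B C : Type*} [AddCommGroup A] [Module R A]
    [AddCommGroup B] [Module R B] [AddCommGroup C] [Module R C] {P : PrimeSpectrum R}
    (f : A →ₗ[R] B) (g : B →ₗ[R] C) (hfg : ∀ b, g b = 0 → ∃ a, f a = b)
    (hA : P ∉ Module.support R A) (hC : P ∉ Module.support R C) : P ∉ Module.support R B := by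
  rw [Module.notMem_support_iff'] at *
  intro b
  obtain ⟨s, hs, hsb⟩ := hC (g b)
  obtain ⟨a, ha⟩ := hfg (s • b) (by rw [map_smul, hsb])
  obtain ⟨t, ht, hta⟩ := hA a
  exact ⟨t * s, P.2.mul_notMem ht hs, by rw [mul_smul, ← ha, ← map_smul, hta, map_zero]⟩

lemma Module.notMem_support_of_ker_le_smul {E C : Type*} [AddCommGroup E] [Module R E]
    [Module.Finite R E] [AddCommGroup C] [Module R C] {P : PrimeSpectrum R} {y : R}
    (hy : y ∈ P.asIdeal) (g : E →ₗ[R] C) (hg : ∀ e, g e = 0 → ∃ e', y • e' = e)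
    (hC : P ∉ Module.support R C) : P ∉ Module.support R E := by
  intro hE
  have h : P ∈ Module.support R (E ⧸ (Ideal.span {y} • ⊤ : Submodule R E)) := by
    rw [Module.support_quotient]
    exact ⟨hE, by simpa [PrimeSpectrum.mem_zeroLocus] using hy⟩
  refine absurd h ?_
  rw [Module.notMem_support_iff'] at hC ⊢
  intro m
  obtain ⟨e, rfl⟩ := Submodule.Quotient.mk_surjective _ m
  obtain ⟨s, hs, hse⟩ := hC (g e)
  obtain ⟨e', he'⟩ := hg (s • e) (by rw [map_smul, hse])
  refine ⟨s, hs, ?_⟩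
  rw [← Submodule.Quotient.mk_smul, ← he', Submodule.Quotient.mk_eq_zero]
  exact Submodule.smul_mem_smul (Ideal.mem_span_singleton_self y) trivial

lemma IsAssociatedPrime.of_linearMap [IsNoetherianRing R] {N M : Type*} [AddCommGroup N]
    [Module R N] [Module.Finite R N] [AddCommGroup M] [Module R M] {p : Ideal R}
    (h : IsAssociatedPrime p (N →ₗ[R] M)) : IsAssociatedPrime p M := by
  rw [isAssociatedPrime_iff] at h ⊢
  obtain ⟨hp, f, hf⟩ := h
  obtain ⟨s, hs⟩ := Module.Finite.fg_top (R := R) (M := N)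
  refine ⟨hp, ?_⟩
  have hle (n : N) : p ≤ (⊥ : Submodule R M).colon {f n} := by
    intro r hr
    rw [hf, Submodule.mem_colon_singleton, Submodule.mem_bot] at hr
    rw [Submodule.mem_colon_singleton, Submodule.mem_bot, ← LinearMap.smul_apply, hr,
      LinearMap.zero_apply]
  have hinf : s.inf (fun n ↦ (⊥ : Submodule R M).colon {f n}) ≤ p := by
    intro r hr
    rw [hf, Submodule.mem_colon_singleton, Submodule.mem_bot]
    refine LinearMap.ext_on hs fun n hn ↦ ?_
    have := Finset.inf_le (f := fun n ↦ (⊥ : Submodule R M).colon {f n}) hn hr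
    rwa [Submodule.mem_colon_singleton, Submodule.mem_bot] at this
  obtain ⟨n, -, hn⟩ := (hp.inf_le').mp hinf
  exact ⟨f n, le_antisymm (hle n) hn⟩

lemma IsAssociatedPrime.mem_support {M : Type*} [IsNoetherianRing R] [AddCommGroup M] [Module R M]
    {P : PrimeSpectrum R} (h : IsAssociatedPrime P.asIdeal M) : P ∈ Module.support R M := by
  obtain ⟨-, x, hx⟩ := isAssociatedPrime_iff.mp h
  rw [Module.mem_support_iff']
  refine ⟨x, fun r hr h0 ↦ hr ?_⟩
  rw [hx, Submodule.mem_colon_singleton, h0]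
  exact zero_mem _

end Support

section Ext

variable {R}

open Abelian

lemma ModuleCat.isAssociatedPrime_quotient_of_isAssociatedPrime_ext [IsNoetherianRing R]
    (N : ModuleCat.{u} R) [Module.Finite R N] {p : Ideal R} (rs : List R)
    (hrs : ∀ r ∈ rs, r ∈ Module.annihilator R N) (M : ModuleCat.{u} R) [Module.Finite R M]
    (reg : RingTheory.Sequence.IsRegular M rs)
    (hp : IsAssociatedPrime p (Abelian.Ext N M rs.length)) :
    IsAssociatedPrime p (M ⧸ (Ideal.ofList rs • ⊤ : Submodule R M)) := by
  induction rs generalizing M with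
  | nil =>
    have e : (M ⧸ (Ideal.ofList ([] : List R) • ⊤ : Submodule R M)) ≃ₗ[R] M :=
      Submodule.quotEquivOfEqBot _ (by rw [Ideal.ofList_nil, Submodule.bot_smul])
    rw [e.isAssociatedPrime_iff]
    let f : Abelian.Ext N M 0 ≃ₗ[R] (N →ₗ[R] M) :=
      Ext.linearEquiv₀.trans ModuleCat.homLinearEquiv
    exact .of_linearMap (f.isAssociatedPrime_iff.mp hp)
  | cons x rs ih =>
    rw [(Submodule.quotOfListConsSMulTopEquivQuotSMulTopInner M x rs).isAssociatedPrime_iff]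
    have hx := hrs x List.mem_cons_self
    have hreg := (RingTheory.Sequence.isRegular_cons_iff _ _ _).mp reg
    refine ih (fun r hr ↦ hrs r (List.mem_cons_of_mem _ hr)) (ModuleCat.of R (QuotSMulTop x M))
      hreg.2 ?_
    have hS := hreg.1.smulShortComplex_shortExact
    have hsub : Subsingleton (Abelian.Ext N M rs.length) := by
      refine ModuleCat.subsingleton_ext_of_exists_isRegular (Ideal.ofList (x :: rs)) N ?_ M
        reg.2.symm.lt_top (x :: rs) (fun r hr ↦ Ideal.subset_span hr) reg _ (by simp)
      rw [Module.support_eq_zeroLocus]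
      exact PrimeSpectrum.zeroLocus_anti_mono (Ideal.span_le.mpr hrs)
    let δ := hS.extClass.postcompOfLinear R N (rfl : rs.length + 1 = rs.length + 1)
    have hinj : Function.Injective δ := by
      rw [injective_iff_map_eq_zero]
      intro e he
      obtain ⟨e', he'⟩ := Ext.covariant_sequence_exact₃ N hS e rfl he
      have : e' = 0 := hsub.elim _ _
      rw [← he', this, Ext.zero_comp]
    have hsurj : Function.Surjective δ := by
      intro e
      refine Ext.covariant_sequence_exact₁ N hS e ?_ rfl
      exact congr($(Ext.postcomp_smul_id_eq_zero_of_mem_annihilator hx (M := M) _) e)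
    exact (LinearEquiv.ofBijective δ ⟨hinj, hsurj⟩).isAssociatedPrime_iff.mpr hp

lemma CategoryTheory.ShortComplex.ShortExact.ext_g_injective
    {S : ShortComplex (ModuleCat.{u} R)} (hS : S.ShortExact) {Y : ModuleCat.{u} R} {i : ℕ}
    (h₁ : ∀ j < i, Subsingleton (Abelian.Ext S.X₁ Y j)) :
    Function.Injective ((Ext.mk₀ S.g).precompOfLinear R Y (zero_add i)) := by
  have := hS.epi_g
  cases i with
  | zero => exact Ext.precomp_mk₀_injective_of_epi Y S.g
  | succ i =>
    rw [injective_iff_map_eq_zero]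
    intro e he
    obtain ⟨e', rfl⟩ := Ext.contravariant_sequence_exact₃ hS Y e he (add_comm 1 i)
    have := h₁ i i.lt_succ_self
    rw [Subsingleton.elim e' 0, Ext.comp_zero]

lemma ModuleCat.smul_ext_eq_zero_of_mem_annihilator {N Y : ModuleCat.{u} R} {i : ℕ} {r : R}
    (hr : r ∈ Module.annihilator R N) (e : Abelian.Ext N Y i) : r • e = 0 := by
  have h : r • 𝟙 N = 0 := by
    ext n
    exact Module.mem_annihilator.mp hr n
  rw [← Ext.mk₀_id_comp e, ← Ext.smul_comp, ← Ext.mk₀_smul, h, Ext.mk₀_zero, Ext.zero_comp]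

lemma ModuleCat.notMem_support_ext_of_notMem_support {N Y : ModuleCat.{u} R} {i : ℕ}
    [Module.Finite R N] {P : PrimeSpectrum R} (hP : P ∉ Module.support R N) :
    P ∉ Module.support R (Abelian.Ext N Y i) := by
  rw [Module.support_eq_zeroLocus, PrimeSpectrum.mem_zeroLocus, SetLike.coe_subset_coe,
    SetLike.not_le_iff_exists] at hP
  obtain ⟨r, hr, hrP⟩ := hP
  exact Module.notMem_support_iff'.mpr
    fun e ↦ ⟨r, hrP, smul_ext_eq_zero_of_mem_annihilator hr e⟩

lemma ModuleCat.notMem_support_ext_of_linearEquiv {M N Y : ModuleCat.{u} R} (f : M ≃ₗ[R] N)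
    {i : ℕ} {P : PrimeSpectrum R} (hP : P ∉ Module.support R (Abelian.Ext N Y i)) :
    P ∉ Module.support R (Abelian.Ext M Y i) := by
  let φ := (Ext.mk₀ f.toModuleIso.inv).precompOfLinear R Y (zero_add i)
  have hφ : Function.Injective φ := by
    rw [injective_iff_map_eq_zero]
    intro e he
    have : (Ext.mk₀ f.toModuleIso.hom).comp (φ e) (zero_add i) = e := by
      change (Ext.mk₀ f.toModuleIso.hom).comp ((Ext.mk₀ f.toModuleIso.inv).comp e
        (zero_add i)) (zero_add i) = e
      rw [Ext.mk₀_comp_mk₀_assoc, Iso.hom_inv_id, Ext.mk₀_id_comp]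
    rw [← this, he, Ext.comp_zero]
  exact fun h ↦ hP (Module.support_subset_of_injective φ hφ h)

namespace CategoryTheory.ShortComplex.ShortExact

variable {S : ShortComplex (ModuleCat.{u} R)} {Y : ModuleCat.{u} R} {i : ℕ} {P : PrimeSpectrum R}

lemma notMem_support_ext_X₂ (hS : S.ShortExact)
    (h₁ : P ∉ Module.support R (Abelian.Ext S.X₁ Y i))
    (h₃ : P ∉ Module.support R (Abelian.Ext S.X₃ Y i)) :
    P ∉ Module.support R (Abelian.Ext S.X₂ Y i) :=
  Module.notMem_support_of_exact ((Ext.mk₀ S.g).precompOfLinear R Y (zero_add i))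
    ((Ext.mk₀ S.f).precompOfLinear R Y (zero_add i))
    (fun e he ↦ Ext.contravariant_sequence_exact₂ hS Y e he) h₃ h₁

lemma notMem_support_ext_X₁ (hS : S.ShortExact)
    (h₂ : P ∉ Module.support R (Abelian.Ext S.X₂ Y i))
    (h₃ : P ∉ Module.support R (Abelian.Ext S.X₃ Y (i + 1))) :
    P ∉ Module.support R (Abelian.Ext S.X₁ Y i) :=
  Module.notMem_support_of_exact ((Ext.mk₀ S.f).precompOfLinear R Y (zero_add i))
    (hS.extClass.precompOfLinear R Y (add_comm 1 i))
    (fun e he ↦ Ext.contravariant_sequence_exact₁ hS Y e (add_comm 1 i) he) h₂ h₃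

lemma notMem_support_ext_X₃ (hS : S.ShortExact)
    (h₁ : ∀ j < i, Subsingleton (Abelian.Ext S.X₁ Y j))
    (h₂ : P ∉ Module.support R (Abelian.Ext S.X₂ Y i)) :
    P ∉ Module.support R (Abelian.Ext S.X₃ Y i) :=
  fun h ↦ h₂ (Module.support_subset_of_injective
    ((Ext.mk₀ S.g).precompOfLinear R Y (zero_add i)) (hS.ext_g_injective h₁) h)

end CategoryTheory.ShortComplex.ShortExact

lemma ModuleCat.notMem_support_ext_of_quotSMulTop [IsNoetherianRing R] {N Y : ModuleCat.{u} R}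
    [Module.Finite R N] [Module.Finite R Y] {i : ℕ} {P : PrimeSpectrum R} {y : R}
    (hyP : y ∈ P.asIdeal) (hy : IsSMulRegular N y)
    (h : P ∉ Module.support R (Abelian.Ext (ModuleCat.of R (QuotSMulTop y N)) Y (i + 1))) :
    P ∉ Module.support R (Abelian.Ext N Y i) := by
  have hS := hy.smulShortComplex_shortExact
  refine Module.notMem_support_of_ker_le_smul hyP
    (hS.extClass.precompOfLinear R Y (add_comm 1 i)) (fun e he ↦ ?_) h
  obtain ⟨e', he'⟩ : ∃ e' : Abelian.Ext N Y i, (Ext.mk₀ (y • 𝟙 N)).comp e' (zero_add i) = e :=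
    Ext.contravariant_sequence_exact₁ hS Y e (add_comm 1 i) he
  have hsmul : (Ext.mk₀ (y • 𝟙 N)).comp e' (zero_add i) = y • e' := by
    rw [Ext.mk₀_smul, Ext.smul_comp, Ext.mk₀_id_comp]
  exact ⟨e', hsmul.symm.trans he'⟩

lemma ModuleCat.notMem_support_ext_of_forall [IsNoetherianRing R] {Y : ModuleCat.{u} R}
    [Module.Finite R Y] {i : ℕ} {P : PrimeSpectrum R}
    (h : ∀ (N : ModuleCat.{u} R) [Module.Finite R N],
      P ∉ Module.support R (Abelian.Ext N Y (i + 1)))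
    (hP : P ∉ Module.support R (Abelian.Ext (ModuleCat.of R (R ⧸ P.asIdeal)) Y i))
    (N : ModuleCat.{u} R) [hN : Module.Finite R N] :
    P ∉ Module.support R (Abelian.Ext N Y i) := by
  refine IsNoetherianRing.induction_on_isQuotientEquivQuotientPrime R hN
    (motive := fun N _ _ _ ↦ P ∉ Module.support R (Abelian.Ext (ModuleCat.of R N) Y i))
    (fun N _ _ _ _ ↦ ?_) (fun N _ _ _ p f ↦ ?_)
    (fun N₁ _ _ _ N₂ _ _ _ N₃ _ _ _ f g hf hg hfg h₁ h₃ ↦ ?_)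
  · exact notMem_support_ext_of_notMem_support (by rw [Module.support_eq_empty]; simp)
  · refine notMem_support_ext_of_linearEquiv (N := ModuleCat.of R (R ⧸ p.asIdeal)) f ?_
    by_cases hle : p.asIdeal ≤ P.asIdeal
    · by_cases hpP : P.asIdeal ≤ p.asIdeal
      · rwa [PrimeSpectrum.ext (le_antisymm hle hpP)]
      · obtain ⟨y, hyP, hyp⟩ := SetLike.not_le_iff_exists.mp hpP
        exact notMem_support_ext_of_quotSMulTop hyP
          ((isSMulRegular_quotient_iff_mem_of_smul_mem p.asIdeal y).mpr
            fun x hx ↦ (p.2.mem_or_mem hx).resolve_left hyp) (h _)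
    · refine notMem_support_ext_of_notMem_support ?_
      rwa [Module.support_eq_zeroLocus, PrimeSpectrum.mem_zeroLocus, SetLike.coe_subset_coe,
        show Module.annihilator R (ModuleCat.of R (R ⧸ p.asIdeal)) = _ from
          Ideal.annihilator_quotient]
  · exact (ModuleCat.shortComplex_shortExact
      (ModuleCat.shortComplexOfCompEqZero f g hfg.linearMap_comp_eq_zero) hfg hf
      hg).notMem_support_ext_X₂ h₁ h₃

lemma ModuleCat.subsingleton_ext_of_support_subset [IsNoetherianRing R] {I : Ideal R} (hI : I ≠ ⊤)
    {g : ℕ} (h : ∀ i < g, Subsingleton (Abelian.Ext (ModuleCat.of R (R ⧸ I)) (ModuleCat.of R R) i))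
    (N : ModuleCat.{u} R) [Module.Finite R N]
    (hN : Module.support R N ⊆ PrimeSpectrum.zeroLocus I) :
    ∀ i < g, Subsingleton (Abelian.Ext N (ModuleCat.of R R) i) := by
  have hlt : I • (⊤ : Submodule R (ModuleCat.of R R)) < ⊤ := by
    change I • (⊤ : Ideal R) < ⊤
    simpa [lt_top_iff_ne_top] using hI
  obtain ⟨rs, rfl, hrs, hreg⟩ := ModuleCat.exists_isRegular_of_exists_subsingleton_ext I g
    (ModuleCat.of R R) hlt (ModuleCat.of R (R ⧸ I))
    (by rw [Module.support_eq_zeroLocus]; exact congrArg (fun J : Ideal R ↦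
          PrimeSpectrum.zeroLocus (J : Set R)) Ideal.annihilator_quotient) h
  exact subsingleton_ext_of_exists_isRegular I N hN (ModuleCat.of R R) hlt rs hrs hreg

lemma ModuleCat.subsingleton_ext_quotient_of_isRegular [IsNoetherianRing R] [IsLocalRing R]
    (rs : List R) (hrs : ∀ r ∈ rs, r ∈ IsLocalRing.maximalIdeal R)
    (reg : RingTheory.Sequence.IsRegular R rs) {i : ℕ} (hi : rs.length < i) (Y : ModuleCat.{u} R) :
    Subsingleton
      (Abelian.Ext (ModuleCat.of R (R ⧸ (Ideal.ofList rs • ⊤ : Submodule R R))) Y i) := by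
  have := (projectiveDimension_le_iff (ModuleCat.of R (R ⧸ (Ideal.ofList rs • ⊤ : Submodule R R)))
    rs.length).mp <| by
    have h := ModuleCat.projectiveDimension_quotient_eq_add_length_of_isWeaklyRegular
      (ModuleCat.of R R) rs reg.1 hrs
    rw [ModuleCat.projectiveDimension_eq_zero_of_projective (ModuleCat.of R R), zero_add] at h
    exact h.le
  exact HasProjectiveDimensionLT.subsingleton _ (rs.length + 1) i hi Y

lemma ModuleCat.notMem_support_ext_of_lt_of_injective [IsNoetherianRing R]
    {Y : ModuleCat.{u} R} [Module.Finite R Y] {n : ℕ}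
    (hn : ∀ i, n < i → ∀ N : ModuleCat.{u} R, Subsingleton (Abelian.Ext N Y i))
    {P : PrimeSpectrum R} {B : ModuleCat.{u} R} [Module.Finite R B] {g : ℕ}
    (hB : ∀ i, g < i → Subsingleton (Abelian.Ext B Y i))
    (f : (R ⧸ P.asIdeal) →ₗ[R] B) (hf : Function.Injective f) {i : ℕ} (hi : g < i)
    (N : ModuleCat.{u} R) [Module.Finite R N] :
    P ∉ Module.support R (Abelian.Ext N Y i) := by
  by_cases hni : n < i
  · have := hn i hni N
    rw [Module.support_eq_empty]
    exact Set.notMem_empty P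
  · refine notMem_support_ext_of_forall (fun N _ ↦ ?_) ?_ N
    · exact notMem_support_ext_of_lt_of_injective hn hB f hf (hi.trans i.lt_succ_self) N
    · have hS := ModuleCat.shortComplex_shortExact
        (ModuleCat.shortComplexOfCompEqZero f (LinearMap.range f).mkQ
          f.exact_map_mkQ_range.linearMap_comp_eq_zero) f.exact_map_mkQ_range hf
        (Submodule.mkQ_surjective _)
      refine hS.notMem_support_ext_X₁ ?_ (notMem_support_ext_of_lt_of_injective hn hB f hf
        (hi.trans i.lt_succ_self) (ModuleCat.of R (B ⧸ LinearMap.range f)))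
      have := hB i hi
      exact (Module.support_eq_empty (R := R) (M := Abelian.Ext B Y i)).symm ▸ Set.notMem_empty P
termination_by n + 1 - i

theorem ModuleCat.eq_of_isAssociatedPrime_ext [IsNoetherianRing R] [IsLocalRing R] {n : ℕ}
    (hn : ∀ i, n < i → ∀ N : ModuleCat.{u} R, Subsingleton (Abelian.Ext N (ModuleCat.of R R) i))
    {q : Ideal R} (hq : q.IsPrime) {g : ℕ}
    (h : ∀ i < g, Subsingleton (Abelian.Ext (ModuleCat.of R (R ⧸ q)) (ModuleCat.of R R) i))
    (N : ModuleCat.{u} R) [Module.Finite R N]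
    (hN : Module.support R N ⊆ PrimeSpectrum.zeroLocus q) {p : Ideal R}
    (hp : IsAssociatedPrime p (Abelian.Ext N (ModuleCat.of R R) g)) : p = q := by
  have hvan := subsingleton_ext_of_support_subset hq.ne_top h
  let P : PrimeSpectrum R := ⟨p, hp.1⟩
  have hPs : P ∈ Module.support R (Abelian.Ext N (ModuleCat.of R R) g) :=
    IsAssociatedPrime.mem_support hp
  have hPN : P ∈ Module.support R N :=
    not_not.mp fun h0 ↦ notMem_support_ext_of_notMem_support h0 hPs
  have hqp : q ≤ p := hN hPN
  refine le_antisymm ?_ hqp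
  by_contra hpq
  obtain ⟨y, hyp, hyq⟩ := SetLike.not_le_iff_exists.mp hpq
  set I := Module.annihilator R N with hI
  have hIp : I ≤ p := Module.annihilator_le_of_mem_support hPN
  have hlt : I • (⊤ : Submodule R (ModuleCat.of R R)) < ⊤ := by
    change I • (⊤ : Ideal R) < ⊤
    have : I ≠ ⊤ := ne_top_of_le_ne_top hp.1.ne_top hIp
    simpa [lt_top_iff_ne_top] using this
  obtain ⟨rs, rfl, hrs, hreg⟩ := ModuleCat.exists_isRegular_of_exists_subsingleton_ext I g
    (ModuleCat.of R R) hlt N Module.support_eq_zeroLocus (hvan N hN)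
  obtain ⟨-, f, hf⟩ := (isAssociatedPrime_iff_exists_injective_linearMap _ _).mp
    (isAssociatedPrime_quotient_of_isAssociatedPrime_ext N rs hrs _ hreg hp)
  have hgt {i : ℕ} (hi : rs.length < i) (M : ModuleCat.{u} R) [Module.Finite R M] :=
    notMem_support_ext_of_lt_of_injective hn (P := P)
      (B := ModuleCat.of R (R ⧸ (Ideal.ofList rs • ⊤ : Submodule R R)))
      (fun i hi ↦ subsingleton_ext_quotient_of_isRegular rs
        (fun r hr ↦ IsLocalRing.le_maximalIdeal hp.1.ne_top (hIp (hrs r hr))) hreg hi _) f hf hi M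
  have hq' : P ∉ Module.support R (Abelian.Ext (ModuleCat.of R (R ⧸ q)) (ModuleCat.of R R)
      rs.length) :=
    notMem_support_ext_of_quotSMulTop hyp ((isSMulRegular_quotient_iff_mem_of_smul_mem q y).mpr
      fun x hx ↦ (hq.mem_or_mem hx).resolve_left hyq) (hgt rs.length.lt_succ_self _)
  have hp' : P ∉ Module.support R (Abelian.Ext (ModuleCat.of R (R ⧸ p)) (ModuleCat.of R R)
      rs.length) := by
    refine (LinearMap.shortExact_shortComplexKer
      (f := Submodule.factor hqp) (Submodule.factor_surjective hqp)).notMem_support_ext_X₃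
      (hvan _ ?_) hq'
    refine (Module.support_subset_of_injective (LinearMap.ker _).subtype
      (LinearMap.ker _).injective_subtype).trans ?_
    rw [Module.support_eq_zeroLocus, Ideal.annihilator_quotient]
  exact notMem_support_ext_of_forall (hgt rs.length.lt_succ_self) hp' N hPs

end Ext

section Comparison

variable {R}

open Abelian

namespace CochainComplex

variable (K : CochainComplex (ModuleCat.{u} R) ℕ) {n : ℕ}

lemma exists_iCycles_eq (x : K.X n) (hx : K.d n (n + 1) x = 0) :
    ∃ z : K.cycles n, K.iCycles n z = x := by
  refine ⟨(K.liftCycles (ModuleCat.ofHom (LinearMap.toSpanSingleton R (K.X n) x)) (n + 1)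
    (by simp) ?_).hom (1 : R), ?_⟩
  · ext
    simpa using hx
  · rw [← ModuleCat.comp_apply, K.liftCycles_i]
    exact one_smul R x

lemma homologyπ_apply_eq_zero_iff (z : K.cycles n) :
    K.homologyπ n z = 0 ↔
      ∃ w : K.X ((ComplexShape.up ℕ).prev n), K.d _ n w = K.iCycles n z := by
  have hex : (ShortComplex.mk (K.toCycles ((ComplexShape.up ℕ).prev n) n) (K.homologyπ n)
      (K.toCycles_comp_homologyπ _ n)).Exact :=
    ShortComplex.exact_of_g_is_cokernel _ (K.homologyIsCokernel _ n rfl)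
  have hinj := (ModuleCat.mono_iff_injective (K.iCycles n)).mp inferInstance
  constructor
  · intro hz
    obtain ⟨w, hw⟩ := (ShortComplex.moduleCat_exact_iff _).mp hex z hz
    exact ⟨w, by rw [← hw, ← ModuleCat.comp_apply, K.toCycles_i]⟩
  · rintro ⟨w, hw⟩
    rw [← K.toCycles_i, ModuleCat.comp_apply] at hw
    rw [← hinj hw, ← ModuleCat.comp_apply, K.toCycles_comp_homologyπ]
    rfl

end CochainComplex

namespace CategoryTheory.ProjectiveResolution

variable {M : ModuleCat.{u} R} (P : ProjectiveResolution M) (Y : ModuleCat.{u} R)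

lemma smul_extMk {Y : ModuleCat.{u} R} {n : ℕ} (r : R) (f : P.complex.X n ⟶ Y) (m : ℕ)
    (hm : n + 1 = m) (hf : P.complex.d m n ≫ f = 0) :
    r • P.extMk f m hm hf = P.extMk (r • f) m hm (by rw [Linear.comp_smul, hf, smul_zero]) := by
  rw [Ext.smul_eq_comp_mk₀, extMk_comp_mk₀]
  simp

lemma extMk_zero_degree_eq_zero_iff {Y : ModuleCat.{u} R} (f : P.complex.X 0 ⟶ Y) (m : ℕ)
    (hm : 0 + 1 = m) (hf : P.complex.d m 0 ≫ f = 0) :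
    P.extMk f m hm hf = 0 ↔ f = 0 := by
  refine ⟨fun h ↦ ?_, fun h ↦ by subst h; exact P.extMk_zero m hm⟩
  rw [← P.extEquivCohomologyClass.apply_eq_iff_eq, extEquivCohomologyClass_extMk,
    extEquivCohomologyClass_zero, CochainComplex.HomComplex.CohomologyClass.mk_eq_zero_iff,
    CochainComplex.HomComplex.Cocycle.toSingleMk_mem_coboundaries_iff _ _ _ _ _ 1 (by lia)] at h
  obtain ⟨g, hg⟩ := h
  have hz : Limits.IsZero (P.cochainComplex.X 1) :=
    P.cochainComplex.isZero_of_isStrictlyLE 0 1 (by lia)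
  rw [hz.eq_of_src g 0, Limits.comp_zero] at hg
  rw [← cancel_epi (P.cochainComplexXIso (-((0 : ℕ) : ℤ)) 0 rfl).hom, Limits.comp_zero]
  exact hg.symm

lemma extMk_eq_zero_iff_exists_prev {Y : ModuleCat.{u} R} {n : ℕ} (f : P.complex.X n ⟶ Y)
    (hf : P.complex.d (n + 1) n ≫ f = 0) :
    P.extMk f (n + 1) rfl hf = 0 ↔
      ∃ g : P.complex.X ((ComplexShape.up ℕ).prev n) ⟶ Y, P.complex.d n _ ≫ g = f := by
  cases n with
  | zero =>
    rw [extMk_zero_degree_eq_zero_iff, P.complex.shape _ _ (by simp)]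
    simp [eq_comm]
  | succ n => rw [CochainComplex.prev_nat_succ]; exact P.extMk_eq_zero_iff f (n + 2) rfl hf n rfl

/-- The cocycle on the projective resolution underlying a cycle of `Hom(P, Y)`. -/
noncomputable def cocycle {n : ℕ} (z : (P.complex.linearYonedaObj R Y).cycles n) :
    P.complex.X n ⟶ Y :=
  ((P.complex.linearYonedaObj R Y).iCycles n).hom z

lemma d_comp_cocycle {n : ℕ} (z : (P.complex.linearYonedaObj R Y).cycles n) :
    P.complex.d (n + 1) n ≫ P.cocycle Y z = 0 :=
  congr(($((P.complex.linearYonedaObj R Y).iCycles_d n (n + 1))).hom z)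

/-- The map from cycles of `Hom(P, Y)` to `Ext` of the derived category. -/
noncomputable def cyclesToExt (n : ℕ) :
    (P.complex.linearYonedaObj R Y).cycles n →ₗ[R] Abelian.Ext M Y n where
  toFun z := P.extMk (P.cocycle Y z) (n + 1) rfl (P.d_comp_cocycle Y z)
  map_add' x y := by
    rw [add_extMk]
    congr 1
    exact map_add _ x y
  map_smul' r x := by
    rw [RingHom.id_apply, smul_extMk]
    congr 1
    exact map_smul _ r x

/-- The map from cycles of `Hom(P, Y)` to `Ext` defined as a left derived functor. -/
noncomputable def cyclesToExtMod (n : ℕ) :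
    (P.complex.linearYonedaObj R Y).cycles n →ₗ[R] ExtMod R n M Y :=
  ((P.complex.linearYonedaObj R Y).homologyπ n ≫ (P.isoExt n Y).inv).hom

lemma cyclesToExt_surjective (n : ℕ) : Function.Surjective (P.cyclesToExt Y n) := by
  intro e
  obtain ⟨f, hf, rfl⟩ := P.extMk_surjective e (n + 1) rfl
  obtain ⟨z, hz⟩ := (P.complex.linearYonedaObj R Y).exists_iCycles_eq f hf
  refine ⟨z, ?_⟩
  change P.extMk (P.cocycle Y z) (n + 1) rfl (P.d_comp_cocycle Y z) = _
  congr 1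

lemma cyclesToExtMod_surjective (n : ℕ) : Function.Surjective (P.cyclesToExtMod Y n) :=
  (ModuleCat.epi_iff_surjective
    ((P.complex.linearYonedaObj R Y).homologyπ n ≫ (P.isoExt n Y).inv)).mp inferInstance

lemma ker_cyclesToExt (n : ℕ) :
    LinearMap.ker (P.cyclesToExt Y n) = LinearMap.ker (P.cyclesToExtMod Y n) := by
  ext z
  have hinj := (ModuleCat.mono_iff_injective (P.isoExt (R := R) n Y).inv).mp inferInstance
  have h : P.cyclesToExtMod Y n z = 0 ↔ (P.complex.linearYonedaObj R Y).homologyπ n z = 0 := by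
    rw [← hinj.eq_iff, map_zero]
    rfl
  rw [LinearMap.mem_ker, LinearMap.mem_ker, h, CochainComplex.homologyπ_apply_eq_zero_iff]
  exact P.extMk_eq_zero_iff_exists_prev (P.cocycle Y z) (P.d_comp_cocycle Y z)

/-- The comparison between the two definitions of `Ext`. -/
noncomputable def extEquivExtMod (n : ℕ) : Abelian.Ext M Y n ≃ₗ[R] ExtMod R n M Y :=
  ((P.cyclesToExt Y n).quotKerEquivOfSurjective (P.cyclesToExt_surjective Y n)).symm ≪≫ₗ
    Submodule.quotEquivOfEq _ _ (P.ker_cyclesToExt Y n) ≪≫ₗ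
    (P.cyclesToExtMod Y n).quotKerEquivOfSurjective (P.cyclesToExtMod_surjective Y n)

lemma extEquivExtMod_cyclesToExt {n : ℕ} (z : (P.complex.linearYonedaObj R Y).cycles n) :
    P.extEquivExtMod Y n (P.cyclesToExt Y n z) = P.cyclesToExtMod Y n z := by
  have : ((P.cyclesToExt Y n).quotKerEquivOfSurjective (P.cyclesToExt_surjective Y n)).symm
      (P.cyclesToExt Y n z) = Submodule.Quotient.mk z := by
    rw [LinearEquiv.symm_apply_eq]
    rfl
  simp only [extEquivExtMod, LinearEquiv.trans_apply, this]
  rfl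

variable {P} {M' : ModuleCat.{u} R} {P' : ProjectiveResolution M'} {φ : M' ⟶ M}

/-- The map on `Hom(-, Y)` complexes induced by a morphism of projective resolutions. -/
noncomputable abbrev Hom.linearYonedaMap (f : Hom P' P φ) :
    P.complex.linearYonedaObj R Y ⟶ P'.complex.linearYonedaObj R Y :=
  (HomologicalComplex.unopFunctor _ _).map
    ((((linearYoneda R (ModuleCat.{u} R)).obj Y).rightOp.mapHomologicalComplex _).map f.hom).op

lemma cyclesToExt_naturality (f : Hom P' P φ) {n : ℕ}
    (z : (P.complex.linearYonedaObj R Y).cycles n) :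
    P'.cyclesToExt Y n (HomologicalComplex.cyclesMap (f.linearYonedaMap Y) n z) =
      (Ext.mk₀ φ).comp (P.cyclesToExt Y n z) (zero_add n) := by
  refine Eq.trans ?_ (mk₀_comp_extMk (P.cocycle Y z) (n + 1) rfl (P.d_comp_cocycle Y z) f).symm
  change P'.extMk (P'.cocycle Y _) (n + 1) rfl (P'.d_comp_cocycle Y _) = _
  congr 1
  exact congr(($(HomologicalComplex.cyclesMap_i (f.linearYonedaMap Y) n)).hom z)

lemma cyclesToExtMod_naturality (f : Hom P' P φ) {n : ℕ}
    (z : (P.complex.linearYonedaObj R Y).cycles n) :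
    P'.cyclesToExtMod Y n (HomologicalComplex.cyclesMap (f.linearYonedaMap Y) n z) =
      (((Ext R (ModuleCat.{u} R) n).map φ.op).app Y).hom (P.cyclesToExtMod Y n z) := by
  have h₁ := HomologicalComplex.homologyπ_naturality (f.linearYonedaMap Y) n
  have h₂ : HomologicalComplex.homologyMap (f.linearYonedaMap Y) n ≫ (P'.isoExt n Y).inv =
      (P.isoExt n Y).inv ≫ ((Ext R (ModuleCat.{u} R) n).map φ.op).app Y := by
    have h₃ := P'.isoLeftDerivedObj_hom_naturality φ P f.hom f.hom_f_zero_comp_π_f_zero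
      ((linearYoneda R (ModuleCat.{u} R)).obj Y).rightOp n
    have h₄ := HomologicalComplex.homologyOp_hom_naturality (f.linearYonedaMap Y) n
    have h₅ : HomologicalComplex.homologyMap (f.linearYonedaMap Y) n ≫
        (HomologicalComplex.homologyUnop _ n).hom =
        (HomologicalComplex.homologyUnop _ n).hom ≫ (HomologicalComplex.homologyMap
          ((((linearYoneda R (ModuleCat.{u} R)).obj Y).rightOp.mapHomologicalComplex _).map
            f.hom) n).unop := congr($(h₄).unop).symm
    have h₆ := congr($(h₃).unop)
    unfold isoExt
    refine (Category.assoc _ _ _).symm.trans ?_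
    refine (congr($h₅ ≫ _)).trans ?_
    refine (Category.assoc _ _ _).trans (Eq.trans ?_ (Category.assoc _ _ _).symm)
    exact congr(_ ≫ $h₆).symm
  have h₃ : HomologicalComplex.cyclesMap (f.linearYonedaMap Y) n ≫
      HomologicalComplex.homologyπ _ n ≫ (P'.isoExt n Y).inv =
      (HomologicalComplex.homologyπ _ n ≫ (P.isoExt n Y).inv) ≫
        ((Ext R (ModuleCat.{u} R) n).map φ.op).app Y := by
    rw [Category.assoc, ← h₂, reassoc_of% h₁]
  exact congr(($h₃).hom z)

lemma extEquivExtMod_naturality (f : Hom P' P φ) {n : ℕ} (e : Abelian.Ext M Y n) :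
    P'.extEquivExtMod Y n ((Ext.mk₀ φ).comp e (zero_add n)) =
      (((Ext R (ModuleCat.{u} R) n).map φ.op).app Y).hom (P.extEquivExtMod Y n e) := by
  obtain ⟨z, rfl⟩ := P.cyclesToExt_surjective Y n e
  rw [← cyclesToExt_naturality Y f, extEquivExtMod_cyclesToExt, extEquivExtMod_cyclesToExt,
    cyclesToExtMod_naturality]

end CategoryTheory.ProjectiveResolution

end Comparison

section Colimit

variable {R}

open Limits

variable {J : Type*} [Category* J] {F : J ⥤ ModuleCat.{u} R} {c : Cocone F}

lemma ModuleCat.injective_ι_of_isFiltered [IsFiltered J] [HasColimitsOfShape J (Type u)]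
    [PreservesColimit F (forget (ModuleCat.{u} R))] (hc : IsColimit c)
    (hF : ∀ ⦃i j : J⦄ (f : i ⟶ j), Function.Injective (F.map f)) (j : J) :
    Function.Injective (c.ι.app j) := by
  intro x y hxy
  obtain ⟨k, f, f', h⟩ := (Concrete.isColimit_rep_eq_iff_exists F hc x y).mp hxy
  apply hF (f ≫ IsFiltered.coeqHom f f')
  have h' := congr(F.map (IsFiltered.coeqHom f f') $h)
  rwa [← ModuleCat.comp_apply, ← F.map_comp, ← ModuleCat.comp_apply, ← F.map_comp,
    ← IsFiltered.coeq_condition] at h'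

lemma ModuleCat.exists_isAssociatedPrime_of_isColimit [IsNoetherianRing R]
    [PreservesColimit F (forget (ModuleCat.{u} R))] (hc : IsColimit c)
    (hι : ∀ j, Function.Injective (c.ι.app j)) {p : Ideal R} (hp : IsAssociatedPrime p c.pt) :
    ∃ j, IsAssociatedPrime p (F.obj j) := by
  rw [isAssociatedPrime_iff] at hp
  obtain ⟨hp, x, rfl⟩ := hp
  obtain ⟨j, y, rfl⟩ := Concrete.isColimit_exists_rep F hc x
  refine ⟨j, isAssociatedPrime_iff.mpr ⟨hp, y, ?_⟩⟩
  ext r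
  rw [Submodule.mem_colon_singleton, Submodule.mem_colon_singleton, Submodule.mem_bot,
    Submodule.mem_bot, ← map_smul, ← (hι j).eq_iff, map_zero]

end Colimit

section LocalCohomology

variable {R}

open Limits

lemma ExtMod.map_injective_of_surjective {M N Y : ModuleCat.{u} R} (f : M →ₗ[R] N)
    (hf : Function.Surjective f) (g : ℕ)
    (h : ∀ j < g, Subsingleton (Abelian.Ext (ModuleCat.of R (LinearMap.ker f)) Y j)) :
    Function.Injective
      (((Ext R (ModuleCat.{u} R) g).map (ModuleCat.ofHom f).op).app Y : ExtMod R g N Y → _) := by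
  let P := projectiveResolution M
  let Q := projectiveResolution N
  let l : ProjectiveResolution.Hom P Q (ModuleCat.ofHom f) :=
    ⟨ProjectiveResolution.lift _ P Q, ProjectiveResolution.lift_commutes_zero _ P Q⟩
  have hinj := (LinearMap.shortExact_shortComplexKer hf).ext_g_injective (Y := Y) h
  intro x y hxy
  obtain ⟨x, rfl⟩ := (Q.extEquivExtMod Y g).surjective x
  obtain ⟨y, rfl⟩ := (Q.extEquivExtMod Y g).surjective y
  refine congr(Q.extEquivExtMod Y g $(hinj ((P.extEquivExtMod Y g).injective ?_)))
  exact (ProjectiveResolution.extEquivExtMod_naturality Y l x).trans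
    (hxy.trans (ProjectiveResolution.extEquivExtMod_naturality Y l y).symm)

lemma Module.support_quotient_pow_subset (I : Ideal R) (t : ℕ) :
    Module.support R (R ⧸ I ^ t) ⊆ PrimeSpectrum.zeroLocus I := by
  rw [Module.support_eq_zeroLocus, Ideal.annihilator_quotient]
  intro p hp
  exact fun x hx ↦ p.2.mem_of_pow_mem t (hp (Ideal.pow_mem_pow hx t))

/-- The system of modules `Ext^g(R ⧸ I ^ t, Y)` whose colimit is local cohomology. -/
noncomputable abbrev localCohomology.extDiagram (I : Ideal R) (g : ℕ) (Y : ModuleCat.{u} R) :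
    ℕᵒᵖᵒᵖ ⥤ ModuleCat.{u} R :=
  diagram (idealPowersDiagram I) g ⋙ (evaluation _ _).obj Y

/-- The cocone exhibiting local cohomology as a colimit of the modules `Ext^g(R ⧸ I ^ t, Y)`. -/
noncomputable abbrev localCohomology.extCocone (I : Ideal R) (g : ℕ) (Y : ModuleCat.{u} R) :
    Cocone (extDiagram I g Y) :=
  ((evaluation _ _).obj Y).mapCocone (colimit.cocone (diagram (idealPowersDiagram I) g))

/-- Local cohomology is a colimit of the modules `Ext^g(R ⧸ I ^ t, Y)`. -/
noncomputable def localCohomology.isColimitExtCocone (I : Ideal R) (g : ℕ) (Y : ModuleCat.{u} R) :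
    IsColimit (extCocone I g Y) :=
  isColimitOfPreserves _ (colimit.isColimit _)

lemma localCohomology.extDiagram_map_injective [IsNoetherianRing R] {I : Ideal R} (hI : I ≠ ⊤)
    {g : ℕ} (h : ∀ i < g, Subsingleton
      (Abelian.Ext (ModuleCat.of R (R ⧸ I)) (ModuleCat.of R R) i))
    ⦃s t : ℕᵒᵖᵒᵖ⦄ (f : s ⟶ t) :
    Function.Injective ((extDiagram I g (ModuleCat.of R R)).map f) := by
  let φ : (R ⧸ I ^ t.unop.unop) →ₗ[R] (R ⧸ I ^ s.unop.unop) :=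
    Submodule.mapQ _ _ LinearMap.id ((idealPowersDiagram I).map f.unop).down.down
  have hφ : Function.Surjective φ := by
    intro x
    obtain ⟨x, rfl⟩ := Submodule.Quotient.mk_surjective _ x
    exact ⟨Submodule.Quotient.mk x, rfl⟩
  refine ExtMod.map_injective_of_surjective (M := ModuleCat.of R _) (N := ModuleCat.of R _) φ hφ g
    (ModuleCat.subsingleton_ext_of_support_subset hI h _ ?_)
  exact (Module.support_subset_of_injective _ (LinearMap.ker φ).injective_subtype).trans
    (Module.support_quotient_pow_subset I _)

end LocalCohomology

/-- Over a Gorenstein local ring, if `𝔮` is a prime of grade `g`, then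
`Ass(H^g_𝔮(R)) = {𝔮}`. -/
theorem associatedPrimes_localCohomology_grade_eq_singleton
    (hGor : IsGorensteinLocalRing R)
    (𝔮 : Ideal R) (h𝔮 : 𝔮.IsPrime) (g : ℕ)
    (hg_ne : Nontrivial (ExtMod R g (ModuleCat.of R (R ⧸ 𝔮)) (ModuleCat.of R R)))
    (hg_min : ∀ i : ℕ, i < g →
      Subsingleton (ExtMod R i (ModuleCat.of R (R ⧸ 𝔮)) (ModuleCat.of R R))) :
    associatedPrimes R ((localCohomology 𝔮 g).obj (ModuleCat.of R R)) = {𝔮} := by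
  obtain ⟨_, _, n, hn⟩ := hGor
  have hExt (N : ModuleCat.{u} R) (i : ℕ) :
      Nonempty (Abelian.Ext N (ModuleCat.of R R) i ≃ₗ[R] ExtMod R i N (ModuleCat.of R R)) :=
    ⟨(projectiveResolution N).extEquivExtMod _ i⟩
  have hn' (i : ℕ) (hi : n < i) (N : ModuleCat.{u} R) :
      Subsingleton (Abelian.Ext N (ModuleCat.of R R) i) :=
    (hExt N i).some.toEquiv.subsingleton_congr.mpr (hn i hi N)
  have hmin (i : ℕ) (hi : i < g) :
      Subsingleton (Abelian.Ext (ModuleCat.of R (R ⧸ 𝔮)) (ModuleCat.of R R) i) :=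
    (hExt _ i).some.toEquiv.subsingleton_congr.mpr (hg_min i hi)
  have := Limits.preservesSmallestFilteredColimits_of_preservesFilteredColimits
    (forget (ModuleCat.{u} R))
  have hc := localCohomology.isColimitExtCocone 𝔮 g (ModuleCat.of R R)
  have hι := ModuleCat.injective_ι_of_isFiltered hc
    (localCohomology.extDiagram_map_injective h𝔮.ne_top hmin)
  have : Nontrivial ((localCohomology 𝔮 g).obj (ModuleCat.of R R)) := by
    rw [← pow_one 𝔮] at hg_ne
    have : Nontrivial ((localCohomology.extDiagram 𝔮 g (ModuleCat.of R R)).obj (op (op 1))) := hg_ne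
    exact (hι (op (op 1))).nontrivial
  obtain ⟨p, hp⟩ := associatedPrimes.nonempty R ((localCohomology 𝔮 g).obj (ModuleCat.of R R))
  refine (Set.Nonempty.subset_singleton_iff ⟨p, hp⟩).mp fun p hp ↦ ?_
  obtain ⟨t, ht⟩ := ModuleCat.exists_isAssociatedPrime_of_isColimit hc hι hp
  exact ModuleCat.eq_of_isAssociatedPrime_ext hn' h𝔮 hmin (ModuleCat.of R (R ⧸ 𝔮 ^ t.unop.unop))
    (Module.support_quotient_pow_subset 𝔮 _) ((hExt _ g).some.isAssociatedPrime_iff.mpr ht)
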